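/- arXiv:1707.04361 — 2 statements merged into one kernel-verified Lean document; each statement's English description precedes it below -/
import Mathlib

section
/- Let n ≥ 4 and let f ∈ L¹(ℝⁿ). Define V(x) := ∫_{ℝⁿ} ((x−y)/|x−y|²) f(y) dy. Then there is a constant C = C(n) depending only on n such that for every r > 0, ∫_{∂B_r(0)} |V(x)| dH^{n−1}(x) ≤ C (∫_{ℝⁿ}|f|) r^{n−2}, where the integral is taken over the sphere of radius r with respect to (n−1)-dimensional Hausdorff measure. -/
open MeasureTheory Metric Filter Set

noncomputable section

/-- Euclidean space `ℝⁿ`. -/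
abbrev Eu (n : ℕ) := EuclideanSpace ℝ (Fin n)

open scoped NNReal ENNReal

/-- On the part of a sphere where the `i`-th coordinate has sign `s` and is comparable to the
radius, forgetting the `i`-th coordinate is bi-Lipschitz with constants independent of `r`. -/
lemma dist_le_mul_dist_removeNth_of_mem_sphere {m : ℕ} {i : Fin (m + 1)} {s r : ℝ} (hr : 0 < r)
    (hs : s ^ 2 = 1) {x x' : EuclideanSpace ℝ (Fin (m + 1))}
    (hx : x ∈ sphere (0 : EuclideanSpace ℝ (Fin (m + 1))) r)
    (hx' : x' ∈ sphere (0 : EuclideanSpace ℝ (Fin (m + 1))) r)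
    (hi : r ≤ (m + 1) * (s * x i)) (hi' : r ≤ (m + 1) * (s * x' i)) :
    dist x x' ≤ m * (m + 2) * dist (fun j => x (i.succAbove j)) (fun j => x' (i.succAbove j)) := by
  set D := dist (fun j => x (i.succAbove j)) (fun j => x' (i.succAbove j)) with hD
  have hD0 : 0 ≤ D := dist_nonneg
  have hDj : ∀ j, |x (i.succAbove j) - x' (i.succAbove j)| ≤ D := fun j =>
    dist_le_pi_dist (fun j => x (i.succAbove j)) (fun j => x' (i.succAbove j)) j
  rw [mem_sphere_zero_iff_norm] at hx hx'
  have hxj : ∀ j, |x j| ≤ r := fun j => hx ▸ PiLp.norm_apply_le x j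
  have hxj' : ∀ j, |x' j| ≤ r := fun j => hx' ▸ PiLp.norm_apply_le x' j
  have e : x i ^ 2 + ∑ j, x (i.succAbove j) ^ 2 = r ^ 2 := by
    rw [← hx, EuclideanSpace.real_norm_sq_eq, Fin.sum_univ_succAbove _ i]
  have e' : x' i ^ 2 + ∑ j, x' (i.succAbove j) ^ 2 = r ^ 2 := by
    rw [← hx', EuclideanSpace.real_norm_sq_eq, Fin.sum_univ_succAbove _ i]
  have hsum : |∑ j, (x (i.succAbove j) ^ 2 - x' (i.succAbove j) ^ 2)| ≤ m * (D * (2 * r)) := by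
    refine (Finset.abs_sum_le_sum_abs _ _).trans ?_
    refine (Finset.sum_le_card_nsmul _ _ (D * (2 * r)) fun j _ => ?_).trans (by simp)
    rw [sq_sub_sq, abs_mul, mul_comm]
    refine mul_le_mul (hDj j) ((abs_add_le _ _).trans ?_) (abs_nonneg _) hD0
    linarith [hxj (i.succAbove j), hxj' (i.succAbove j)]
  have hsi : |x i - x' i| ≤ m * (m + 1) * D := by
    have h1 : |x i - x' i| * (2 * r) ≤ (m + 1) * (m * (D * (2 * r))) := by
      calc |x i - x' i| * (2 * r)
          ≤ |x i - x' i| * |(m + 1) * (s * x i + s * x' i)| := by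
            refine mul_le_mul_of_nonneg_left (le_trans ?_ (le_abs_self _)) (abs_nonneg _)
            linarith
        _ = (m + 1) * |∑ j, (x (i.succAbove j) ^ 2 - x' (i.succAbove j) ^ 2)| := by
            have hsa : |s| = 1 := by
              rw [← sq_eq_sq₀ (abs_nonneg _) zero_le_one, sq_abs, hs, one_pow]
            have h2 : ∑ j, (x (i.succAbove j) ^ 2 - x' (i.succAbove j) ^ 2)
                = - ((x i - x' i) * (x i + x' i)) := by
              rw [Finset.sum_sub_distrib]; linarith
            rw [h2, ← mul_add, abs_neg, abs_mul, abs_mul, abs_mul, hsa,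
              abs_of_nonneg (by positivity : (0 : ℝ) ≤ m + 1)]
            ring
        _ ≤ _ := by gcongr
    have h3 : 0 < 2 * r := by linarith
    refine le_of_mul_le_mul_right (h1.trans_eq ?_) h3
    ring
  have hnorm : dist x x' ≤ ∑ j, |x j - x' j| := by
    rw [EuclideanSpace.dist_eq]
    refine Real.sqrt_le_iff.2 ⟨Finset.sum_nonneg fun _ _ => abs_nonneg _, ?_⟩
    simp only [Real.dist_eq]
    exact Finset.sum_sq_le_sq_sum_of_nonneg fun _ _ => abs_nonneg _
  rw [Fin.sum_univ_succAbove _ i] at hnorm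
  have hrest : ∑ j, |x (i.succAbove j) - x' (i.succAbove j)| ≤ m * D :=
    (Finset.sum_le_card_nsmul _ _ D fun j _ => hDj j).trans (by simp)
  linarith

/-- A point of a sphere has a coordinate comparable to the radius. -/
lemma exists_coord_ge_of_mem_sphere {m : ℕ} {r : ℝ}
    {x : EuclideanSpace ℝ (Fin (m + 1))}
    (hx : x ∈ sphere (0 : EuclideanSpace ℝ (Fin (m + 1))) r) :
    ∃ i, r ≤ (m + 1) * |x i| := by
  by_contra! h
  rw [mem_sphere_zero_iff_norm] at hx
  have h1 : ‖x‖ ≤ ∑ j, |x j| := by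
    rw [EuclideanSpace.norm_eq]
    refine Real.sqrt_le_iff.2 ⟨Finset.sum_nonneg fun _ _ => abs_nonneg _, ?_⟩
    exact Finset.sum_sq_le_sq_sum_of_nonneg fun _ _ => abs_nonneg _
  have h2 : ∑ j, (m + 1) * |x j| < ∑ _j : Fin (m + 1), r :=
    Finset.sum_lt_sum_of_nonempty Finset.univ_nonempty fun j _ => h j
  rw [← Finset.mul_sum] at h2
  simp only [Finset.sum_const, Finset.card_univ, Fintype.card_fin, nsmul_eq_mul, Nat.cast_add,
    Nat.cast_one] at h2
  have := lt_of_mul_lt_mul_left h2 (by positivity)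
  linarith

/-- Upper Ahlfors regularity of round spheres, uniformly in the radius of the sphere. -/
lemma hausdorffMeasure_sphere_inter_closedBall_le (m : ℕ) :
    ∃ A : ℝ≥0, ∀ r : ℝ, 0 < r → ∀ (y : EuclideanSpace ℝ (Fin (m + 1))) (ρ : ℝ), 0 ≤ ρ →
      μH[(m : ℝ)] (sphere (0 : EuclideanSpace ℝ (Fin (m + 1))) r ∩ closedBall y ρ)
        ≤ A * ENNReal.ofReal ρ ^ m := by
  set K : ℝ≥0 := m * (m + 2) with hK
  refine ⟨(m + 1) * (2 * (K ^ m * 2 ^ m)), fun r hr y ρ hρ => ?_⟩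
  set P : Fin (m + 1) → ℝ → Set (EuclideanSpace ℝ (Fin (m + 1))) := fun i s =>
    {x | (x ∈ sphere (0 : EuclideanSpace ℝ (Fin (m + 1))) r ∧ x ∈ closedBall y ρ) ∧
      r ≤ (m + 1) * (s * x i)} with hP
  have hpatch : ∀ i s, s ^ 2 = 1 →
      μH[(m : ℝ)] (P i s) ≤ K ^ m * 2 ^ m * ENNReal.ofReal ρ ^ m := by
    intro i s hs
    set F : P i s → (Fin m → ℝ) := fun x j => (x : EuclideanSpace ℝ (Fin (m + 1))) (i.succAbove j)
    have hF : AntilipschitzWith K F := AntilipschitzWith.of_le_mul_dist fun x x' => by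
      have := dist_le_mul_dist_removeNth_of_mem_sphere hr hs x.2.1.1 x'.2.1.1 x.2.2 x'.2.2
      rw [hK]
      push_cast
      exact this
    have h1 : μH[(m : ℝ)] (P i s) = μH[(m : ℝ)] (univ : Set (P i s)) := by
      rw [← (isometry_subtype_coe (s := P i s)).hausdorffMeasure_image (Or.inl m.cast_nonneg)]
      simp
    have h2 : F '' univ ⊆ closedBall (fun j => y (i.succAbove j)) ρ := by
      rintro _ ⟨x, -, rfl⟩
      rw [mem_closedBall, dist_pi_le_iff hρ]
      intro j
      refine le_trans ?_ x.2.1.2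
      rw [dist_eq_norm, dist_eq_norm]
      exact PiLp.norm_apply_le ((x : EuclideanSpace ℝ (Fin (m + 1))) - y) (i.succAbove j)
    have hvol : (μH[(m : ℝ)] : Measure (Fin m → ℝ)) = volume := by
      simpa using hausdorffMeasure_pi_real (ι := Fin m)
    calc μH[(m : ℝ)] (P i s) ≤ (K : ℝ≥0∞) ^ (m : ℝ) * μH[(m : ℝ)] (F '' univ) :=
          h1 ▸ hF.le_hausdorffMeasure_image m.cast_nonneg univ
      _ ≤ (K : ℝ≥0∞) ^ (m : ℝ) * ENNReal.ofReal ((2 * ρ) ^ m) := by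
          gcongr
          refine (measure_mono h2).trans_eq ?_
          rw [hvol, Real.volume_pi_closedBall _ hρ, Fintype.card_fin]
      _ = _ := by
          rw [ENNReal.rpow_natCast, ENNReal.ofReal_pow (by positivity),
            ENNReal.ofReal_mul zero_le_two, mul_pow, mul_assoc]
          simp
  have hcover : sphere (0 : EuclideanSpace ℝ (Fin (m + 1))) r ∩ closedBall y ρ
      ⊆ ⋃ i, (P i 1 ∪ P i (-1)) := by
    rintro x hx
    obtain ⟨i, hi⟩ := exists_coord_ge_of_mem_sphere hx.1
    refine mem_iUnion.2 ⟨i, ?_⟩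
    rcases abs_cases (x i) with h | h
    · exact Or.inl ⟨hx, by rwa [one_mul, ← h.1]⟩
    · exact Or.inr ⟨hx, by rwa [neg_one_mul, ← h.1]⟩
  calc _ ≤ ∑ i, μH[(m : ℝ)] (P i 1 ∪ P i (-1)) :=
        (measure_mono hcover).trans (measure_iUnion_fintype_le _ _)
    _ ≤ ∑ _i : Fin (m + 1), 2 * (K ^ m * 2 ^ m * ENNReal.ofReal ρ ^ m) := by
        refine Finset.sum_le_sum fun i _ => (measure_union_le _ _).trans ?_
        rw [two_mul]
        exact add_le_add (hpatch i 1 (by norm_num)) (hpatch i (-1) (by norm_num))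
    _ = _ := by
        simp only [Finset.sum_const, Finset.card_univ, Fintype.card_fin, nsmul_eq_mul]
        push_cast
        ring

/-- Dyadic upper bound for the inverse of a positive number. -/
lemma ofReal_inv_le_add_tsum {t r : ℝ} (ht : 0 ≤ t) (hr : 0 < r) :
    ENNReal.ofReal t⁻¹ ≤ ENNReal.ofReal r⁻¹ +
      ∑' k : ℕ, if t ≤ r * (1 / 2) ^ k then ENNReal.ofReal (2 ^ (k + 1) * r⁻¹) else 0 := by
  rcases ht.eq_or_lt with rfl | ht
  · simp
  rcases le_or_gt t r with h | h
  · obtain ⟨k, hk1, hk2⟩ := exists_nat_pow_near_of_lt_one (x := t / r) (y := (1 / 2 : ℝ))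
      (by positivity) (by rwa [div_le_one hr]) (by norm_num) (by norm_num)
    rw [lt_div_iff₀ hr] at hk1
    rw [div_le_iff₀ hr, mul_comm] at hk2
    refine le_trans ?_ (le_add_of_nonneg_left zero_le)
    refine le_trans ?_ (ENNReal.le_tsum k)
    rw [if_pos hk2]
    refine ENNReal.ofReal_le_ofReal ((inv_anti₀ (by positivity) hk1.le).trans_eq ?_)
    rw [mul_inv, one_div, inv_pow, inv_inv]
  · exact le_add_of_le_of_nonneg
      (ENNReal.ofReal_le_ofReal (inv_anti₀ hr h.le)) zero_le

/-- The Riesz kernel `|x - y|⁻¹` integrated over a sphere of radius `r`, uniformly in the pole. -/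
lemma lintegral_sphere_inv_norm_sub_le (m : ℕ) :
    ∃ C : ℝ≥0, ∀ r : ℝ, 0 < r → ∀ y : EuclideanSpace ℝ (Fin (m + 3)),
      ∫⁻ x in sphere (0 : EuclideanSpace ℝ (Fin (m + 3))) r, ENNReal.ofReal ‖x - y‖⁻¹
        ∂μH[((m + 2 : ℕ) : ℝ)] ≤ C * ENNReal.ofReal r ^ (m + 1) := by
  obtain ⟨A, hA⟩ := hausdorffMeasure_sphere_inter_closedBall_le (m + 2)
  refine ⟨5 * A, fun r hr y => ?_⟩
  set S := sphere (0 : EuclideanSpace ℝ (Fin (m + 3))) r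
  have hS : MeasurableSet S := isClosed_sphere.measurableSet
  have hHS : μH[((m + 2 : ℕ) : ℝ)] S ≤ A * ENNReal.ofReal r ^ (m + 2) := by
    have h := hA r hr 0 r hr.le
    rwa [inter_eq_left.2 sphere_subset_closedBall] at h
  have hrinv : ENNReal.ofReal r⁻¹ * ENNReal.ofReal r = 1 := by
    rw [← ENNReal.ofReal_mul (by positivity), inv_mul_cancel₀ hr.ne', ENNReal.ofReal_one]
  have hmeas : ∀ k : ℕ, Measurable fun x : EuclideanSpace ℝ (Fin (m + 3)) =>
      if ‖x - y‖ ≤ r * (1 / 2) ^ k then ENNReal.ofReal (2 ^ (k + 1) * r⁻¹) else 0 := fun k =>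
    Measurable.ite (measurableSet_le (by fun_prop) measurable_const) measurable_const
      measurable_const
  have hterm : ∀ k : ℕ, ∫⁻ x in S,
      (if ‖x - y‖ ≤ r * (1 / 2) ^ k then ENNReal.ofReal (2 ^ (k + 1) * r⁻¹) else 0)
        ∂μH[((m + 2 : ℕ) : ℝ)] ≤ 2 * A * ENNReal.ofReal r ^ (m + 1) * (2⁻¹) ^ k := by
    intro k
    have h1 : (fun x : EuclideanSpace ℝ (Fin (m + 3)) =>
        if ‖x - y‖ ≤ r * (1 / 2) ^ k then ENNReal.ofReal (2 ^ (k + 1) * r⁻¹) else 0)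
        = (closedBall y (r * (1 / 2) ^ k)).indicator
          fun _ => ENNReal.ofReal (2 ^ (k + 1) * r⁻¹) := by
      ext x
      simp [indicator, mem_closedBall, dist_eq_norm]
    rw [h1, lintegral_indicator_const isClosed_closedBall.measurableSet,
      Measure.restrict_apply isClosed_closedBall.measurableSet, inter_comm]
    refine (mul_le_mul_right (hA r hr y _ (by positivity)) _).trans ?_
    have h2 : (2 : ℝ) ^ (k + 1) * ((1 / 2) ^ k) ^ (m + 2) ≤ 2 * (1 / 2) ^ k := by
      have h3 : ((1 / 2 : ℝ) ^ k) ^ (m + 2) ≤ ((1 / 2 : ℝ) ^ k) ^ 2 :=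
        pow_le_pow_of_le_one (by positivity) (pow_le_one₀ (by norm_num) (by norm_num)) (by omega)
      calc (2 : ℝ) ^ (k + 1) * ((1 / 2) ^ k) ^ (m + 2)
          ≤ 2 ^ (k + 1) * ((1 / 2) ^ k) ^ 2 := by gcongr
        _ = 2 * (1 / 2) ^ k * (2 * (1 / 2)) ^ k := by rw [mul_pow]; ring
        _ = _ := by norm_num
    calc ENNReal.ofReal (2 ^ (k + 1) * r⁻¹) * (A * ENNReal.ofReal (r * (1 / 2) ^ k) ^ (m + 2))
        = A * ENNReal.ofReal r ^ (m + 1) *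
            ENNReal.ofReal (2 ^ (k + 1) * ((1 / 2) ^ k) ^ (m + 2)) := by
          rw [ENNReal.ofReal_mul (by positivity), ENNReal.ofReal_mul hr.le,
            ENNReal.ofReal_mul (by positivity), ENNReal.ofReal_pow (by positivity) (m + 2),
            mul_pow, pow_succ (ENNReal.ofReal r) (m + 1)]
          calc _ = (ENNReal.ofReal r⁻¹ * ENNReal.ofReal r) * (A * ENNReal.ofReal r ^ (m + 1) *
              (ENNReal.ofReal (2 ^ (k + 1)) * ENNReal.ofReal ((1 / 2) ^ k) ^ (m + 2))) := by ring
            _ = _ := by rw [hrinv, one_mul]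
      _ ≤ A * ENNReal.ofReal r ^ (m + 1) * ENNReal.ofReal (2 * (1 / 2) ^ k) := by gcongr
      _ = _ := by
          rw [ENNReal.ofReal_mul zero_le_two, ENNReal.ofReal_pow (by norm_num), one_div,
            ENNReal.ofReal_inv_of_pos zero_lt_two, ENNReal.ofReal_ofNat]
          ring
  calc _ ≤ ∫⁻ x in S, (ENNReal.ofReal r⁻¹ + ∑' k : ℕ,
        if ‖x - y‖ ≤ r * (1 / 2) ^ k then ENNReal.ofReal (2 ^ (k + 1) * r⁻¹) else 0)
        ∂μH[((m + 2 : ℕ) : ℝ)] :=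
        lintegral_mono fun x => ofReal_inv_le_add_tsum (norm_nonneg _) hr
    _ = ENNReal.ofReal r⁻¹ * μH[((m + 2 : ℕ) : ℝ)] S + ∑' k : ℕ, ∫⁻ x in S,
        (if ‖x - y‖ ≤ r * (1 / 2) ^ k then ENNReal.ofReal (2 ^ (k + 1) * r⁻¹) else 0)
        ∂μH[((m + 2 : ℕ) : ℝ)] := by
        rw [lintegral_add_left measurable_const, setLIntegral_const,
          lintegral_tsum fun k => (hmeas k).aemeasurable]
    _ ≤ ENNReal.ofReal r⁻¹ * (A * ENNReal.ofReal r ^ (m + 2)) +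
        ∑' k : ℕ, 2 * A * ENNReal.ofReal r ^ (m + 1) * (2⁻¹) ^ k :=
        add_le_add (mul_le_mul_right hHS _) (ENNReal.tsum_le_tsum hterm)
    _ = (ENNReal.ofReal r⁻¹ * ENNReal.ofReal r) * (A * ENNReal.ofReal r ^ (m + 1)) +
        2 * A * ENNReal.ofReal r ^ (m + 1) * 2 := by
        rw [ENNReal.tsum_mul_left, ENNReal.tsum_geometric, ENNReal.one_sub_inv_two, inv_inv]
        ring
    _ = _ := by
        rw [hrinv]
        push_cast
        ring

/-- **Sphere L¹ estimate for the gradient of a logarithmic potential.** For `f ∈ L¹(ℝⁿ)`,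
`n ≥ 4`, and `V(x) = ∫ ((x-y)/|x-y|²) f(y) dy`, one has
`∫_{∂B_r} |V| dH^{n-1} ≤ C(n) (∫|f|) r^{n-2}`. -/
theorem sphere_L1_gradient_estimate
    (n : ℕ) (hn : 4 ≤ n) :
    ∃ C : ℝ, 0 < C ∧
      ∀ f : Eu n → ℝ, Integrable f →
        ∀ V : Eu n → Eu n,
          (∀ x, V x = ∫ y, f y • ((‖x - y‖ ^ 2)⁻¹ • (x - y))) →
            ∀ r : ℝ, 0 < r →
              (∫ x in sphere (0 : Eu n) r, ‖V x‖ ∂μH[((n : ℝ) - 1)]) ≤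
                C * (∫ y, |f y|) * r ^ (n - 2) := by
  obtain ⟨m, rfl⟩ : ∃ m, n = m + 3 := ⟨n - 3, by omega⟩
  obtain ⟨C, hC⟩ := lintegral_sphere_inv_norm_sub_le m
  obtain ⟨A, hA⟩ := hausdorffMeasure_sphere_inter_closedBall_le (m + 2)
  refine ⟨C + 1, by positivity, fun f hf V hV r hr => ?_⟩
  have hdim : (((m + 3 : ℕ) : ℝ) - 1) = ((m + 2 : ℕ) : ℝ) := by push_cast; ring
  rw [hdim, show m + 3 - 2 = m + 1 by omega]
  set S := sphere (0 : Eu (m + 3)) r with hS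
  have hfin : μH[((m + 2 : ℕ) : ℝ)] S < ∞ := by
    have h := hA r hr 0 r hr.le
    rw [inter_eq_left.2 sphere_subset_closedBall] at h
    refine h.trans_lt ?_
    exact ENNReal.mul_lt_top ENNReal.coe_lt_top (ENNReal.pow_lt_top ENNReal.ofReal_lt_top)
  have : IsFiniteMeasure ((μH[((m + 2 : ℕ) : ℝ)] : Measure (Eu (m + 3))).restrict S) :=
    ⟨by rwa [Measure.restrict_apply_univ]⟩
  set g := hf.1.mk f with hg
  have hgm : Measurable g := hf.1.stronglyMeasurable_mk.measurable
  have hfg : f =ᵐ[volume] g := hf.1.ae_eq_mk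
  have hVx : ∀ x, ‖V x‖ₑ ≤ ∫⁻ y, ‖g y‖ₑ * ENNReal.ofReal ‖x - y‖⁻¹ := by
    intro x
    rw [hV x]
    refine (enorm_integral_le_lintegral_enorm _).trans_eq (lintegral_congr_ae ?_)
    filter_upwards [hfg] with y hy
    rw [enorm_smul, hy, ← ofReal_norm (_ • (x - y)), norm_smul, norm_inv, norm_pow, norm_norm]
    congr 2
    rcases eq_or_ne ‖x - y‖ 0 with h | h
    · simp [h]
    · field_simp
  have hfI : ∫⁻ y, ‖g y‖ₑ = ENNReal.ofReal (∫ y, |f y|) := by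
    rw [← lintegral_congr_ae (hfg.mono fun y hy => congrArg enorm hy)]
    exact (ofReal_integral_norm_eq_lintegral_enorm hf).symm
  have hI0 : 0 ≤ ∫ y, |f y| := integral_nonneg fun _ => abs_nonneg _
  have key : ∫⁻ x in S, ‖V x‖ₑ ∂μH[((m + 2 : ℕ) : ℝ)]
      ≤ ENNReal.ofReal ((C + 1) * (∫ y, |f y|) * r ^ (m + 1)) := by
    calc _ ≤ ∫⁻ x in S, (∫⁻ y, ‖g y‖ₑ * ENNReal.ofReal ‖x - y‖⁻¹) ∂μH[((m + 2 : ℕ) : ℝ)] :=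
          lintegral_mono hVx
      _ = ∫⁻ y, ∫⁻ x in S, ‖g y‖ₑ * ENNReal.ofReal ‖x - y‖⁻¹ ∂μH[((m + 2 : ℕ) : ℝ)] := by
          refine lintegral_lintegral_swap (Measurable.aemeasurable ?_)
          unfold Function.uncurry
          fun_prop
      _ ≤ ∫⁻ y, ‖g y‖ₑ * (C * ENNReal.ofReal r ^ (m + 1)) := by
          refine lintegral_mono fun y => ?_
          rw [lintegral_const_mul _ (by fun_prop)]
          exact mul_le_mul_right (hC r hr y) _
      _ = ENNReal.ofReal (C * (∫ y, |f y|) * r ^ (m + 1)) := by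
          rw [lintegral_mul_const _ hgm.enorm, hfI, ENNReal.ofReal_mul (by positivity),
            ENNReal.ofReal_mul C.coe_nonneg, ENNReal.ofReal_pow hr.le, ENNReal.ofReal_coe_nnreal]
          ring
      _ ≤ _ := by
          gcongr
          linarith
  by_cases hint : Integrable (fun x => ‖V x‖)
      ((μH[((m + 2 : ℕ) : ℝ)] : Measure (Eu (m + 3))).restrict S)
  · rw [integral_eq_lintegral_of_nonneg_ae (Eventually.of_forall fun _ => norm_nonneg _) hint.1]
    refine ENNReal.toReal_le_of_le_ofReal (by positivity) ?_
    simpa only [ofReal_norm] using key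
  · rw [integral_undef hint]
    positivity
end
end

section
/- Let n ≥ 4 be even, and let f ∈ C^∞(ℝⁿ) with ∫_{ℝⁿ}|f| dx < ∞. Then v(x) := ∫_{ℝⁿ} log(|y|/|x−y|) f(y) dy is a well-defined smooth function and there is a constant C = C(n) depending only on n such that for every r > 0, |∫_{B_{2r}(0)∖B_r(0)} Δv dx| ≤ C (∫_{ℝⁿ}|f|) r^{n−2}; in particular |⨍_{B_{2r}(0)∖B_r(0)} Δv dx| ≤ C (∫|f|) r^{−2}. -/
open MeasureTheory Metric Filter Set

noncomputable section

/-- The Euclidean Laplacian `Δu(x) = ∑ᵢ ∂²u/∂xᵢ²`. -/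
def lap {n : ℕ} (u : Eu n → ℝ) (x : Eu n) : ℝ :=
  ∑ i : Fin n, iteratedFDeriv ℝ 2 u x ![EuclideanSpace.single i 1, EuclideanSpace.single i 1]

lemma nontrivial_eu {n : ℕ} (hn : 4 ≤ n) : Nontrivial (Eu n) := by
  have : Nonempty (Fin n) := ⟨⟨0, by omega⟩⟩
  infer_instance

/-- The directional derivative of `u` along the `i`-th coordinate vector. -/
def coordDeriv {n : ℕ} (i : Fin n) (u : Eu n → ℝ) (x : Eu n) : ℝ :=
  fderiv ℝ u x (EuclideanSpace.single i 1)

/-- The kernel `‖z‖⁻²`, valued in `[0, ∞]`. -/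
def invSq {n : ℕ} (z : Eu n) : ENNReal := (‖z‖ₑ ^ 2)⁻¹

lemma measurable_invSq {n : ℕ} : Measurable (invSq (n := n)) := by
  unfold invSq; fun_prop

lemma invSq_eq_ofReal {n : ℕ} {z : Eu n} (hz : z ≠ 0) :
    invSq z = ENNReal.ofReal ((‖z‖ ^ 2)⁻¹) := by
  have : 0 < ‖z‖ ^ 2 := by positivity
  rw [invSq, ENNReal.ofReal_inv_of_pos this, ← ofReal_norm,
    ENNReal.ofReal_pow (norm_nonneg _)]

lemma integrableOn_inv_norm_sq {n : ℕ} (hn : 4 ≤ n) (r : ℝ) :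
    IntegrableOn (fun z : Eu n => (‖z‖ ^ 2)⁻¹) (ball 0 r) := by
  have := nontrivial_eu hn
  rw [integrableOn_fun_norm_addHaar volume (f := fun t => (t ^ 2)⁻¹)]
  simp only [finrank_euclideanSpace, Fintype.card_fin]
  have h : IntegrableOn (fun y : ℝ => y ^ (n - 3)) (Ioo 0 r) :=
    ((continuous_pow (n - 3)).continuousOn.integrableOn_Icc (a := 0) (b := r)).mono_set
      Ioo_subset_Icc_self
  refine h.congr_fun (fun y hy => ?_) measurableSet_Ioo
  have hy0 : y ≠ 0 := hy.1.ne'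
  obtain ⟨m, rfl⟩ : ∃ m, n = m + 3 := ⟨n - 3, by omega⟩
  simp only [Nat.add_sub_cancel, smul_eq_mul, show m + 3 - 1 = m + 2 by omega]
  field_simp
  ring

lemma locallyIntegrable_inv_norm_sq {n : ℕ} (hn : 4 ≤ n) :
    LocallyIntegrable (fun z : Eu n => (‖z‖ ^ 2)⁻¹) := fun x =>
  ⟨ball 0 (‖x‖ + 1), isOpen_ball.mem_nhds (by simp), integrableOn_inv_norm_sq hn _⟩

lemma abs_log_le_of_pos {t : ℝ} (ht : 0 < t) : |Real.log t| ≤ t + 1 + (t ^ 2)⁻¹ := by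
  have h1 := Real.log_le_sub_one_of_pos ht
  have h2 := Real.log_le_sub_one_of_pos (inv_pos.2 ht)
  rw [Real.log_inv] at h2
  have h3 : 0 < t⁻¹ := inv_pos.2 ht
  rw [← inv_pow]
  rw [abs_le]
  constructor <;> nlinarith [sq_nonneg (t⁻¹ - 1), sq_nonneg t⁻¹]

lemma locallyIntegrable_log_norm {n : ℕ} (hn : 4 ≤ n) :
    LocallyIntegrable (fun z : Eu n => Real.log ‖z‖) := by
  have hc : LocallyIntegrable (fun z : Eu n => ‖z‖ + 1) :=
    (by fun_prop : Continuous fun z : Eu n => ‖z‖ + 1).locallyIntegrable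
  refine (hc.add (locallyIntegrable_inv_norm_sq hn)).mono
    (Real.measurable_log.comp measurable_norm).aestronglyMeasurable (ae_of_all _ fun z => ?_)
  simp only [Pi.add_apply, Real.norm_eq_abs]
  rcases eq_or_ne z 0 with rfl | hz
  · simp
  · exact (abs_log_le_of_pos (norm_pos_iff.2 hz)).trans (le_abs_self _)

lemma contDiff_coordDeriv {n : ℕ} (i : Fin n) {h : Eu n → ℝ} (hh : ContDiff ℝ (⊤ : ℕ∞) h) :
    ContDiff ℝ (⊤ : ℕ∞) (coordDeriv i h) :=
  (hh.fderiv_right (m := (⊤ : ℕ∞)) (by simp)).clm_apply contDiff_const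

lemma hasCompactSupport_coordDeriv {n : ℕ} (i : Fin n) {h : Eu n → ℝ} (hh : HasCompactSupport h) :
    HasCompactSupport (coordDeriv i h) :=
  (hh.fderiv ℝ).comp_left (g := fun L : Eu n →L[ℝ] ℝ => L (EuclideanSpace.single i 1)) (by simp)

open scoped Convolution in
lemma coordDeriv_convolution {n : ℕ} (i : Fin n) {k h : Eu n → ℝ} (hk : LocallyIntegrable k)
    (hh : ContDiff ℝ (⊤ : ℕ∞) h) (hc : HasCompactSupport h) :
    coordDeriv i (k ⋆[ContinuousLinearMap.mul ℝ ℝ, volume] h) =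
      k ⋆[ContinuousLinearMap.mul ℝ ℝ, volume] (coordDeriv i h) := by
  ext x
  have h1 : ContDiff ℝ 1 h := hh.of_le (by exact_mod_cast le_top)
  rw [coordDeriv, (hc.hasFDerivAt_convolution_right (ContinuousLinearMap.mul ℝ ℝ) hk h1 x).fderiv,
    convolution_precompR_apply _ hk (hc.fderiv ℝ) (h1.continuous_fderiv one_ne_zero)]
  rfl

open scoped Convolution in
lemma convolution_coordDeriv {n : ℕ} (i : Fin n) {k h : Eu n → ℝ} (hk : ContDiff ℝ (⊤ : ℕ∞) k)
    (hh : ContDiff ℝ (⊤ : ℕ∞) h) (hc : HasCompactSupport h) :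
    k ⋆[ContinuousLinearMap.mul ℝ ℝ, volume] (coordDeriv i h) =
      (coordDeriv i k) ⋆[ContinuousLinearMap.mul ℝ ℝ, volume] h := by
  ext x
  have h1 : ContDiff ℝ 1 h := hh.of_le (by exact_mod_cast le_top)
  have hd : Differentiable ℝ h := h1.differentiable one_ne_zero
  have hf : ∀ t, fderiv ℝ (fun t => h (x - t)) t (EuclideanSpace.single i 1)
      = - coordDeriv i h (x - t) := by
    intro t
    have : HasFDerivAt (fun t => h (x - t)) ((fderiv ℝ h (x - t)).comp (-ContinuousLinearMap.id ℝ (Eu n))) t :=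
      ((hd (x - t)).hasFDerivAt).comp t ((hasFDerivAt_id t).const_sub x)
    rw [this.fderiv]; simp [coordDeriv]
  have key := integral_mul_fderiv_eq_neg_fderiv_mul_of_integrable (μ := (volume : Measure (Eu n)))
    (f := k) (g := fun t => h (x - t)) (v := EuclideanSpace.single i 1) ?_ ?_ ?_ ?_ ?_
  · simp only [hf] at key
    simp only [convolution, ContinuousLinearMap.mul_apply']
    simp only [mul_neg, integral_neg, neg_inj] at key
    exact key
  · exact hc.convolutionExists_right (ContinuousLinearMap.mul ℝ ℝ)
      (contDiff_coordDeriv i hk).continuous.locallyIntegrable hh.continuous x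
  · simp only [hf, mul_neg]
    exact ((hasCompactSupport_coordDeriv i hc).convolutionExists_right (ContinuousLinearMap.mul ℝ ℝ)
      hk.continuous.locallyIntegrable (contDiff_coordDeriv i hh).continuous x).neg
  · exact hc.convolutionExists_right (ContinuousLinearMap.mul ℝ ℝ)
      hk.continuous.locallyIntegrable hh.continuous x
  · intro y _; exact (hk.differentiable (by simp)) y
  · intro y _; exact (hd _).comp y (by fun_prop)

/-- The smooth regularisation `½ log (‖z‖² + ε²)` of `log ‖z‖`. -/
def regLog {n : ℕ} (ε : ℝ) (z : Eu n) : ℝ := Real.log (‖z‖ ^ 2 + ε ^ 2) / 2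

lemma contDiff_regLog {n : ℕ} {ε : ℝ} (hε : 0 < ε) : ContDiff ℝ (⊤ : ℕ∞) (regLog (n := n) ε) := by
  unfold regLog
  refine ContDiff.div_const (ContDiff.log ((contDiff_norm_sq ℝ).add contDiff_const) fun z => ?_) _
  positivity

lemma hasFDerivAt_norm_sq_add {n : ℕ} (c : ℝ) (z : Eu n) :
    HasFDerivAt (fun z : Eu n => ‖z‖ ^ 2 + c) (2 • innerSL ℝ z) z :=
  (hasStrictFDerivAt_norm_sq z).hasFDerivAt.add_const c

lemma coordDeriv_regLog {n : ℕ} (i : Fin n) {ε : ℝ} (hε : 0 < ε) :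
    coordDeriv i (regLog (n := n) ε) = fun z => z i / (‖z‖ ^ 2 + ε ^ 2) := by
  ext z
  have hq : ‖z‖ ^ 2 + ε ^ 2 ≠ 0 := by positivity
  have h := ((hasFDerivAt_norm_sq_add (ε ^ 2) z).log hq).mul_const (1 / 2)
  have h' : regLog (n := n) ε = fun z => Real.log (‖z‖ ^ 2 + ε ^ 2) * (1 / 2) := by
    ext z; simp [regLog, div_eq_mul_inv]
  rw [coordDeriv, h', h.fderiv]
  simp [EuclideanSpace.inner_single_right]
  field_simp

lemma coordDeriv_coordDeriv_regLog {n : ℕ} (i : Fin n) {ε : ℝ} (hε : 0 < ε) (z : Eu n) :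
    coordDeriv i (coordDeriv i (regLog (n := n) ε)) z =
      1 / (‖z‖ ^ 2 + ε ^ 2) - 2 * z i ^ 2 / (‖z‖ ^ 2 + ε ^ 2) ^ 2 := by
  have hq : ‖z‖ ^ 2 + ε ^ 2 ≠ 0 := by positivity
  have hp : HasFDerivAt (fun z : Eu n => z i) (EuclideanSpace.proj (𝕜 := ℝ) i) z :=
    (EuclideanSpace.proj (𝕜 := ℝ) i).hasFDerivAt
  have h := hp.mul ((hasDerivAt_inv hq).comp_hasFDerivAt z (hasFDerivAt_norm_sq_add (ε ^ 2) z))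
  have h' : (fun z : Eu n => z i / (‖z‖ ^ 2 + ε ^ 2)) =
      (fun z : Eu n => z i) * ((fun y => y⁻¹) ∘ fun z : Eu n => ‖z‖ ^ 2 + ε ^ 2) := by
    ext z; simp [div_eq_mul_inv]
  rw [coordDeriv_regLog i hε, coordDeriv, h', h.fderiv]
  simp [EuclideanSpace.inner_single_right]
  field_simp
  ring

lemma abs_second_deriv_log_le {q s t : ℝ} (hq : 0 < q) (hs : s ^ 2 ≤ q) (ht : 0 < t) (htq : t ≤ q) :
    |1 / q - 2 * s ^ 2 / q ^ 2| ≤ 3 * t⁻¹ := by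
  have h1 : 1 / q ≤ t⁻¹ := by rw [one_div]; exact inv_anti₀ ht htq
  have h2 : s ^ 2 / q ^ 2 ≤ 1 / q := by
    rw [div_le_div_iff₀ (by positivity) hq]; nlinarith
  have h3 : 0 ≤ s ^ 2 / q ^ 2 := by positivity
  have h4 : 0 < 1 / q := by positivity
  rw [mul_div_assoc, abs_le]
  constructor <;> linarith

lemma enorm_coordDeriv_coordDeriv_regLog_le {n : ℕ} (i : Fin n) {ε : ℝ} (hε : 0 < ε) (z : Eu n) :
    ‖coordDeriv i (coordDeriv i (regLog (n := n) ε)) z‖ₑ ≤ 3 * invSq z := by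
  rcases eq_or_ne z 0 with rfl | hz
  · simp [invSq]
  · rw [invSq_eq_ofReal hz, coordDeriv_coordDeriv_regLog i hε, Real.enorm_eq_ofReal_abs,
      show (3 : ENNReal) = ENNReal.ofReal 3 by simp, ← ENNReal.ofReal_mul (by norm_num)]
    have hi : z i ^ 2 ≤ ‖z‖ ^ 2 := by
      have := PiLp.norm_apply_le z i
      rw [← sq_abs, ← Real.norm_eq_abs]; gcongr
    exact ENNReal.ofReal_le_ofReal (abs_second_deriv_log_le (by positivity)
      (by nlinarith [sq_nonneg ε]) (by positivity) (by nlinarith [sq_nonneg ε]))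

lemma abs_regLog_le {n : ℕ} {ε : ℝ} (hε : 0 < ε) (hε1 : ε ≤ 1) {z : Eu n} (hz : z ≠ 0) :
    |regLog ε z| ≤ |Real.log ‖z‖| + (‖z‖ ^ 2 + 1) := by
  have hz' : 0 < ‖z‖ ^ 2 := by positivity
  have h1 : Real.log (‖z‖ ^ 2 + ε ^ 2) ≤ ‖z‖ ^ 2 + ε ^ 2 - 1 :=
    Real.log_le_sub_one_of_pos (by positivity)
  have h2 : Real.log (‖z‖ ^ 2) ≤ Real.log (‖z‖ ^ 2 + ε ^ 2) :=
    Real.log_le_log hz' (by nlinarith [sq_nonneg ε])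
  rw [Real.log_pow] at h2
  push_cast at h2
  have h3 := neg_abs_le (Real.log ‖z‖)
  have h4 := abs_nonneg (Real.log ‖z‖)
  have h5 : ε ^ 2 ≤ 1 := by nlinarith
  rw [regLog, abs_le]
  constructor <;> nlinarith

open scoped Convolution Topology in
lemma tendsto_convolution_regLog {n : ℕ} (hn : 4 ≤ n) {h : Eu n → ℝ} (hh : Continuous h)
    (hc : HasCompactSupport h) (x : Eu n) :
    Tendsto (fun m : ℕ => (regLog (1 / ((m : ℝ) + 1)) ⋆[ContinuousLinearMap.mul ℝ ℝ, volume] h) x)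
      atTop (𝓝 (((fun z : Eu n => Real.log ‖z‖) ⋆[ContinuousLinearMap.mul ℝ ℝ, volume] h) x)) := by
  have := nontrivial_eu hn
  have hpos : ∀ m : ℕ, 0 < 1 / ((m : ℝ) + 1) := fun m => by positivity
  have hne : ∀ᵐ z : Eu n, z ≠ 0 := by simp [ae_iff]
  have hb : LocallyIntegrable (fun z : Eu n => |Real.log ‖z‖| + (‖z‖ ^ 2 + 1)) :=
    LocallyIntegrable.add (fun x => (locallyIntegrable_log_norm hn x).norm)
      (by fun_prop : Continuous fun z : Eu n => ‖z‖ ^ 2 + 1).locallyIntegrable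
  refine tendsto_integral_of_dominated_convergence
    (fun z => (|Real.log ‖z‖| + (‖z‖ ^ 2 + 1)) * |h (x - z)|) (fun m => ?_) ?_ (fun m => ?_) ?_
  · exact (hc.convolutionExists_right (ContinuousLinearMap.mul ℝ ℝ)
      (contDiff_regLog (hpos m)).continuous.locallyIntegrable hh x).aestronglyMeasurable
  · exact hc.norm.convolutionExists_right (ContinuousLinearMap.mul ℝ ℝ) hb hh.norm x
  · filter_upwards [hne] with z hz
    simp only [ContinuousLinearMap.mul_apply', norm_mul, Real.norm_eq_abs]
    refine mul_le_mul_of_nonneg_right (abs_regLog_le (hpos m) ?_ hz) (abs_nonneg _)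
    rw [div_le_one (by positivity)]
    have : (0 : ℝ) ≤ m := by positivity
    linarith
  · filter_upwards [hne] with z hz
    simp only [ContinuousLinearMap.mul_apply']
    refine Tendsto.mul_const _ ?_
    have h0 : Tendsto (fun m : ℕ => ‖z‖ ^ 2 + (1 / ((m : ℝ) + 1)) ^ 2) atTop (𝓝 (‖z‖ ^ 2)) := by
      simpa using (tendsto_one_div_add_atTop_nhds_zero_nat (𝕜 := ℝ)).pow 2 |>.const_add (‖z‖ ^ 2)
    have hz' : ‖z‖ ^ 2 ≠ 0 := by positivity
    have := (h0.log hz').div_const 2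
    rw [Real.log_pow] at this
    simpa [regLog] using this

lemma log_potential_eq_convolution {n : ℕ} (h : Eu n → ℝ) :
    (fun x => ∫ y, Real.log ‖x - y‖ * h y) =
      convolution (fun z : Eu n => Real.log ‖z‖) h (ContinuousLinearMap.mul ℝ ℝ) volume := by
  ext x
  rw [convolution_mul_swap]

lemma contDiff_log_potential {n : ℕ} (hn : 4 ≤ n) {h : Eu n → ℝ} (hh : ContDiff ℝ (⊤ : ℕ∞) h)
    (hc : HasCompactSupport h) : ContDiff ℝ (⊤ : ℕ∞) fun x => ∫ y, Real.log ‖x - y‖ * h y := by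
  rw [log_potential_eq_convolution]
  exact hc.contDiff_convolution_right _ (locallyIntegrable_log_norm hn) hh

lemma enorm_coordDeriv_coordDeriv_log_potential_le {n : ℕ} (hn : 4 ≤ n) {h : Eu n → ℝ}
    (hh : ContDiff ℝ (⊤ : ℕ∞) h) (hc : HasCompactSupport h) (i : Fin n) (x : Eu n) :
    ‖coordDeriv i (coordDeriv i fun x => ∫ y, Real.log ‖x - y‖ * h y) x‖ₑ ≤
      3 * ∫⁻ y, invSq (x - y) * ‖h y‖ₑ := by
  have hk := locallyIntegrable_log_norm hn
  have hh1 := contDiff_coordDeriv i hh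
  have hc1 := hasCompactSupport_coordDeriv i hc
  rw [log_potential_eq_convolution, coordDeriv_convolution i hk hh hc,
    coordDeriv_convolution i hk hh1 hc1]
  refine le_of_tendsto (tendsto_convolution_regLog hn (contDiff_coordDeriv i hh1).continuous
    (hasCompactSupport_coordDeriv i hc1) x).enorm (Eventually.of_forall fun m => ?_)
  have hε : 0 < 1 / ((m : ℝ) + 1) := by positivity
  have hs := contDiff_regLog (n := n) hε
  rw [convolution_coordDeriv i hs hh1 hc1, convolution_coordDeriv i (contDiff_coordDeriv i hs) hh hc,
    convolution_mul_swap]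
  refine (enorm_integral_le_lintegral_enorm _).trans ?_
  rw [← lintegral_const_mul' _ _ (by simp)]
  refine lintegral_mono fun y => ?_
  rw [enorm_mul, ← mul_assoc]
  gcongr
  exact enorm_coordDeriv_coordDeriv_regLog_le i hε _

/-- Inversion in the unit sphere. -/
def unitInv {n : ℕ} (y : Eu n) : Eu n := (‖y‖ ^ 2)⁻¹ • y

lemma measurable_unitInv {n : ℕ} : Measurable (unitInv (n := n)) := by
  unfold unitInv; fun_prop

lemma norm_unitInv {n : ℕ} (y : Eu n) : ‖unitInv y‖ = ‖y‖⁻¹ := by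
  rcases eq_or_ne y 0 with rfl | hy
  · simp [unitInv]
  · have : ‖y‖ ≠ 0 := norm_ne_zero_iff.2 hy
    rw [unitInv, norm_smul, norm_inv, norm_pow, norm_norm]
    field_simp

lemma unitInv_unitInv {n : ℕ} (y : Eu n) : unitInv (unitInv y) = y := by
  rcases eq_or_ne y 0 with rfl | hy
  · simp [unitInv]
  · have : ‖y‖ ≠ 0 := norm_ne_zero_iff.2 hy
    rw [unitInv, norm_unitInv, unitInv, smul_smul]
    have : ((‖y‖⁻¹ ^ 2)⁻¹ * (‖y‖ ^ 2)⁻¹) = 1 := by field_simp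
    rw [this, one_smul]

/-- The kernel `log (‖y‖ / ‖x - y‖)` in terms of `x` and the inverted point `w = y / ‖y‖²`. -/
def invKernel {n : ℕ} (x w : Eu n) : ℝ :=
  -(Real.log (1 - 2 * inner ℝ x w + ‖x‖ ^ 2 * ‖w‖ ^ 2) / 2)

lemma invKernel_unitInv {n : ℕ} (x : Eu n) {y : Eu n} (hy : y ≠ 0) :
    invKernel x (unitInv y) = Real.log (‖y‖ / ‖x - y‖) := by
  have hy' : ‖y‖ ≠ 0 := norm_ne_zero_iff.2 hy
  have h : 1 - 2 * inner ℝ x (unitInv y) + ‖x‖ ^ 2 * ‖unitInv y‖ ^ 2 =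
      ((‖y‖ / ‖x - y‖)⁻¹) ^ 2 := by
    rw [norm_unitInv, unitInv, inner_smul_right, inv_div, div_pow, norm_sub_sq_real]
    field_simp
    ring
  rw [invKernel, h, Real.log_pow, Real.log_inv]
  push_cast
  ring

lemma invKernel_arg_pos {n : ℕ} {x w : Eu n} (h : ‖x‖ * ‖w‖ < 1) :
    0 < 1 - 2 * inner ℝ x w + ‖x‖ ^ 2 * ‖w‖ ^ 2 := by
  have := real_inner_le_norm x w
  nlinarith [sq_pos_of_pos (sub_pos.2 h)]

open scoped Topology in
lemma contDiffOn_cutoff_mul_invKernel {n : ℕ} {R a : ℝ} (hR : 0 < R) (ha : a < 1 / R)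
    {ψ : Eu n → ℝ} (hψ : ContDiff ℝ (⊤ : ℕ∞) ψ) (hψ0 : ∀ t, a ≤ ‖t‖ → ψ t = 0) :
    ContDiffOn ℝ (⊤ : ℕ∞) (fun p : Eu n × Eu n => ψ p.2 * invKernel p.1 (-p.2))
      (ball 0 R ×ˢ univ) := by
  rintro ⟨x, t⟩ ⟨hx, -⟩
  apply ContDiffAt.contDiffWithinAt
  rw [mem_ball_zero_iff] at hx
  by_cases ht : ‖t‖ < 1 / R
  · have hpos := invKernel_arg_pos (x := x) (w := -t) (by
      rw [norm_neg]
      calc ‖x‖ * ‖t‖ ≤ ‖x‖ * (1 / R) := by gcongr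
        _ < R * (1 / R) := by gcongr
        _ = 1 := by field_simp)
    have hf : ContDiff ℝ (⊤ : ℕ∞) fun p : Eu n × Eu n => p.1 := contDiff_fst
    have hs : ContDiff ℝ (⊤ : ℕ∞) fun p : Eu n × Eu n => -p.2 := contDiff_snd.neg
    have hin : ContDiff ℝ (⊤ : ℕ∞) fun p : Eu n × Eu n => inner ℝ p.1 (-p.2) := hf.inner ℝ hs
    have h1 : ContDiff ℝ (⊤ : ℕ∞) fun p : Eu n × Eu n =>
        1 - 2 * inner ℝ p.1 (-p.2) + ‖p.1‖ ^ 2 * ‖-p.2‖ ^ 2 :=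
      (contDiff_const.sub (contDiff_const.mul hin)).add ((hf.norm_sq ℝ).mul (hs.norm_sq ℝ))
    have h2 : ContDiff ℝ (⊤ : ℕ∞) fun p : Eu n × Eu n => ψ p.2 := hψ.comp contDiff_snd
    obtain ⟨q, hq⟩ : ∃ q : Eu n × Eu n → ℝ, q = fun p : Eu n × Eu n =>
        1 - 2 * inner ℝ p.1 (-p.2) + ‖p.1‖ ^ 2 * ‖-p.2‖ ^ 2 := ⟨_, rfl⟩
    have hq0 : q (x, t) ≠ 0 := by rw [hq]; exact hpos.ne'
    rw [← hq] at h1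
    have h3 : ContDiffAt ℝ (⊤ : ℕ∞) (fun p => ψ p.2 * -(Real.log (q p) / 2)) (x, t) :=
      h2.contDiffAt.mul ((h1.contDiffAt.log hq0).div_const 2).neg
    simpa only [invKernel, hq] using h3
  · have hmem : {p : Eu n × Eu n | a < ‖p.2‖} ∈ 𝓝 (x, t) :=
      (isOpen_lt continuous_const continuous_snd.norm).mem_nhds (ha.trans_le (not_lt.1 ht))
    refine contDiffAt_const (c := (0 : ℝ)) |>.congr_of_eventuallyEq ?_
    filter_upwards [hmem] with p hp
    rw [hψ0 p.2 (le_of_lt hp), zero_mul]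

/-- The potential of a density vanishing near the origin is smooth near the origin. -/
lemma contDiffOn_far_potential {n : ℕ} {R : ℝ} (hR : 0 < R) {g : Eu n → ℝ} (hg : Continuous g)
    (hgi : Integrable g) (hg0 : ∀ y, ‖y‖ < 2 * R → g y = 0) :
    ContDiffOn ℝ (⊤ : ℕ∞) (fun x => ∫ y, Real.log (‖y‖ / ‖x - y‖) * g y) (ball 0 R) := by
  obtain ⟨ψ, hψs, hψ1, hψ0⟩ : ∃ ψ : Eu n → ℝ, ContDiff ℝ (⊤ : ℕ∞) ψ ∧
      (∀ t, ‖t‖ ≤ 1 / (2 * R) → ψ t = 1) ∧ ∀ t, 2 / (3 * R) ≤ ‖t‖ → ψ t = 0 := by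
    let ψ : ContDiffBump (0 : Eu n) :=
      { rIn := 1 / (2 * R), rOut := 2 / (3 * R), rIn_pos := by positivity,
        rIn_lt_rOut := by rw [div_lt_div_iff₀ (by positivity) (by positivity)]; linarith }
    exact ⟨ψ, ψ.contDiff, fun t ht => ψ.one_of_mem_closedBall (mem_closedBall_zero_iff.2 ht),
      fun t ht => ψ.zero_of_le_dist (by rwa [dist_zero_right])⟩
  let G : Eu n → Eu n → ℝ := fun x t => ψ t * invKernel x (-t)
  have hGsmooth : ContDiffOn ℝ (⊤ : ℕ∞) (↿G) (ball 0 R ×ˢ univ) :=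
    contDiffOn_cutoff_mul_invKernel (a := 2 / (3 * R)) hR
      (by rw [div_lt_div_iff₀ (by positivity) (by positivity)]; linarith) hψs hψ0
  have hGk : ∀ p, ∀ t, p ∈ ball (0 : Eu n) R → t ∉ closedBall (0 : Eu n) (2 / (3 * R)) → G p t = 0 := by
    intro p t _ ht
    rw [mem_closedBall, not_le] at ht
    rw [dist_zero_right] at ht
    have : ψ t = 0 := hψ0 t ht.le
    simp [G, this]
  let μ : Measure (Eu n) := volume.map unitInv
  have hgu : Measurable fun t => g (unitInv t) := hg.measurable.comp measurable_unitInv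
  have hf : LocallyIntegrable (fun t => g (unitInv t)) μ := by
    refine Integrable.locallyIntegrable ?_
    rw [integrable_map_measure hgu.aestronglyMeasurable measurable_unitInv.aemeasurable]
    simpa [Function.comp_def, unitInv_unitInv] using hgi
  have key := contDiffOn_convolution_right_with_param_comp (ContinuousLinearMap.mul ℝ ℝ)
    (v := fun _ : Eu n => (0 : Eu n)) contDiffOn_const isOpen_ball
    (isCompact_closedBall _ _) hGk hf hGsmooth
  refine key.congr fun x hx => ?_
  have hψ : Measurable ψ := hψs.continuous.measurable
  rw [convolution_def, integral_map measurable_unitInv.aemeasurable]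
  · refine integral_congr_ae (ae_of_all _ fun y => ?_)
    simp only [unitInv_unitInv, ContinuousLinearMap.mul_apply', G, zero_sub, neg_neg]
    by_cases hy : ‖y‖ < 2 * R
    · simp [hg0 y hy]
    · rw [not_lt] at hy
      have hy0 : y ≠ 0 := norm_pos_iff.1 (by linarith)
      have : ψ (-unitInv y) = 1 := hψ1 _ (by
        rw [norm_neg, norm_unitInv, ← one_div]
        exact one_div_le_one_div_of_le (by positivity) hy)
      rw [this, invKernel_unitInv x hy0]
      ring
  · refine Measurable.aestronglyMeasurable ?_
    simp only [ContinuousLinearMap.mul_apply', G, zero_sub, neg_neg]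
    refine hgu.mul ((hψ.comp measurable_neg).mul ?_)
    unfold invKernel
    fun_prop

open scoped Topology in
lemma coordDeriv_integral_mul {n : ℕ} {R M : ℝ} {F F' : Eu n → Eu n → ℝ} {g u : Eu n → ℝ}
    (i : Fin n) (hgi : Integrable g) (hg0 : ∀ y, ‖y‖ < 2 * R → g y = 0)
    (hF : ∀ x, Measurable (F x)) (hF' : ∀ x, Measurable (F' x))
    (hFM : ∀ x ∈ ball (0 : Eu n) R, ∀ y, 2 * R ≤ ‖y‖ → |F x y| ≤ M)
    (hFM' : ∀ x ∈ ball (0 : Eu n) R, ∀ y, 2 * R ≤ ‖y‖ → |F' x y| ≤ M)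
    (hd : ∀ x y, ∀ t : ℝ, x + t • EuclideanSpace.single i 1 ∈ ball (0 : Eu n) R → 2 * R ≤ ‖y‖ →
      HasDerivAt (fun t : ℝ => F (x + t • EuclideanSpace.single i 1) y)
        (F' (x + t • EuclideanSpace.single i 1) y) t)
    (hu : ∀ x ∈ ball (0 : Eu n) R, u x = ∫ y, F x y * g y)
    {x : Eu n} (hx : x ∈ ball (0 : Eu n) R) (hux : DifferentiableAt ℝ u x) :
    coordDeriv i u x = ∫ y, F' x y * g y := by
  have hcont : Continuous fun t : ℝ => x + t • EuclideanSpace.single i (1 : ℝ) := by fun_prop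
  have hs : {t : ℝ | x + t • EuclideanSpace.single i 1 ∈ ball (0 : Eu n) R} ∈ 𝓝 (0 : ℝ) :=
    (isOpen_ball.preimage hcont).mem_nhds (by simpa using hx)
  have hbd : ∀ {H : Eu n → Eu n → ℝ}, (∀ x ∈ ball (0 : Eu n) R, ∀ y, 2 * R ≤ ‖y‖ → |H x y| ≤ M) →
      ∀ x ∈ ball (0 : Eu n) R, ∀ y, ‖H x y * g y‖ ≤ M * |g y| := by
    intro H hH x hx y
    rw [norm_mul, Real.norm_eq_abs, Real.norm_eq_abs]
    by_cases hy : ‖y‖ < 2 * R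
    · simp [hg0 y hy]
    · exact mul_le_mul_of_nonneg_right (hH x hx y (not_lt.1 hy)) (abs_nonneg _)
  have hMi : Integrable fun y => M * |g y| := hgi.norm.const_mul M
  have hgm := hgi.aestronglyMeasurable
  have key := hasDerivAt_integral_of_dominated_loc_of_deriv_le (μ := (volume : Measure (Eu n)))
    (F := fun t y => F (x + t • EuclideanSpace.single i 1) y * g y)
    (F' := fun t y => F' (x + t • EuclideanSpace.single i 1) y * g y)
    (bound := fun y => M * |g y|) hs
    (Eventually.of_forall fun t => (hF _).aestronglyMeasurable.mul hgm) ?_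
    ((hF' _).aestronglyMeasurable.mul hgm) (ae_of_all _ fun y t ht => hbd hFM' _ ht y) hMi ?_
  · have h2 : HasLineDerivAt ℝ u (∫ y, F' x y * g y) x (EuclideanSpace.single i 1) := by
      have := key.2
      simp only [zero_smul, add_zero] at this
      refine this.congr_of_eventuallyEq ?_
      filter_upwards [hs] with t ht using hu _ ht
    rw [coordDeriv, ← hux.lineDeriv_eq_fderiv, h2.lineDeriv]
  · refine hMi.mono' ((hF _).aestronglyMeasurable.mul hgm) (ae_of_all _ fun y => ?_)
    exact hbd hFM _ (by simpa using hx) y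
  · refine ae_of_all _ fun y t ht => ?_
    by_cases hy : ‖y‖ < 2 * R
    · simp only [hg0 y hy, mul_zero]
      exact hasDerivAt_const _ _
    · exact (hd x y t ht (not_lt.1 hy)).mul_const _

lemma le_norm_sub {n : ℕ} {R : ℝ} {x y : Eu n} (hx : x ∈ ball (0 : Eu n) R) (hy : 2 * R ≤ ‖y‖) :
    R ≤ ‖x - y‖ := by
  rw [mem_ball_zero_iff] at hx
  have := norm_sub_norm_le y x
  rw [norm_sub_rev] at this
  linarith

lemma abs_log_norm_div_le {n : ℕ} {R : ℝ} (hR : 0 < R) {x y : Eu n} (hx : x ∈ ball (0 : Eu n) R)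
    (hy : 2 * R ≤ ‖y‖) : |Real.log (‖y‖ / ‖x - y‖)| ≤ 6 := by
  have h1 := le_norm_sub hx hy
  rw [mem_ball_zero_iff] at hx
  have h2 := norm_sub_norm_le y x
  rw [norm_sub_rev] at h2
  have h3 := norm_sub_le x y
  have hp : 0 < ‖x - y‖ := hR.trans_le h1
  have hy0 : 0 < ‖y‖ := by linarith
  have hs : ‖y‖ / ‖x - y‖ ≤ 2 := by rw [div_le_iff₀ hp]; linarith
  have hs' : ‖x - y‖ / ‖y‖ ≤ 3 / 2 := by rw [div_le_iff₀ hy0]; linarith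
  have h0 : 0 < ‖x - y‖ / ‖y‖ := by positivity
  refine (abs_log_le_of_pos (by positivity)).trans ?_
  rw [← inv_pow, inv_div]
  nlinarith

lemma hasDerivAt_log_norm_div {n : ℕ} (i : Fin n) {x y : Eu n} {t : ℝ} (hy : y ≠ 0)
    (hp : x + t • EuclideanSpace.single i (1 : ℝ) - y ≠ 0) :
    HasDerivAt (fun t : ℝ => Real.log (‖y‖ / ‖x + t • EuclideanSpace.single i (1 : ℝ) - y‖))
      (-((x + t • EuclideanSpace.single i (1 : ℝ) - y) i /
        ‖x + t • EuclideanSpace.single i (1 : ℝ) - y‖ ^ 2)) t := by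
  have hpath : HasDerivAt (fun t : ℝ => x + t • EuclideanSpace.single i (1 : ℝ) - y)
      (EuclideanSpace.single i (1 : ℝ)) t := by
    simpa using (((hasDerivAt_id t).smul_const (EuclideanSpace.single i (1 : ℝ))).const_add x).sub_const y
  have hy0 : ‖y‖ ≠ 0 := norm_ne_zero_iff.2 hy
  have hp0 : ‖x + t • EuclideanSpace.single i (1 : ℝ) - y‖ ≠ 0 := norm_ne_zero_iff.2 hp
  have h := ((hpath.norm_sq.div_const (‖y‖ ^ 2)).log (by positivity)).div_const (-2)
  have he : (fun t : ℝ => Real.log (‖y‖ / ‖x + t • EuclideanSpace.single i (1 : ℝ) - y‖)) =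
      fun t : ℝ => Real.log (‖x + t • EuclideanSpace.single i (1 : ℝ) - y‖ ^ 2 / ‖y‖ ^ 2) / (-2) := by
    ext s
    rw [← div_pow, Real.log_pow, ← inv_div, Real.log_inv]
    push_cast
    ring
  rw [he]
  refine h.congr_deriv ?_
  rw [EuclideanSpace.inner_single_right]
  simp only [one_mul, conj_trivial]
  field_simp

lemma hasDerivAt_neg_coord_div_norm_sq {n : ℕ} (i : Fin n) {x y : Eu n} {t : ℝ}
    (hp : x + t • EuclideanSpace.single i (1 : ℝ) - y ≠ 0) :
    HasDerivAt (fun t : ℝ => -((x + t • EuclideanSpace.single i (1 : ℝ) - y) i /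
        ‖x + t • EuclideanSpace.single i (1 : ℝ) - y‖ ^ 2))
      (-(1 / ‖x + t • EuclideanSpace.single i (1 : ℝ) - y‖ ^ 2 -
        2 * (x + t • EuclideanSpace.single i (1 : ℝ) - y) i ^ 2 /
          (‖x + t • EuclideanSpace.single i (1 : ℝ) - y‖ ^ 2) ^ 2)) t := by
  have hpath : HasDerivAt (fun t : ℝ => x + t • EuclideanSpace.single i (1 : ℝ) - y)
      (EuclideanSpace.single i (1 : ℝ)) t := by
    simpa using (((hasDerivAt_id t).smul_const (EuclideanSpace.single i (1 : ℝ))).const_add x).sub_const y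
  have hp0 : ‖x + t • EuclideanSpace.single i (1 : ℝ) - y‖ ^ 2 ≠ 0 :=
    pow_ne_zero 2 (norm_ne_zero_iff.2 hp)
  have hc : HasDerivAt (fun t : ℝ => (x + t • EuclideanSpace.single i (1 : ℝ) - y) i) 1 t := by
    simpa [Function.comp_def] using
      (EuclideanSpace.proj (𝕜 := ℝ) i).hasFDerivAt.comp_hasDerivAt t hpath
  have h := (hc.div hpath.norm_sq hp0).neg
  refine h.congr_deriv ?_
  rw [EuclideanSpace.inner_single_right]
  simp only [one_mul, conj_trivial]
  field_simp

lemma abs_coord_le_norm {n : ℕ} (z : Eu n) (i : Fin n) : |z i| ≤ ‖z‖ := PiLp.norm_apply_le z i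

lemma enorm_coordDeriv_coordDeriv_far_potential_le {n : ℕ} {R : ℝ} (hR : 0 < R) {g : Eu n → ℝ}
    (hg : Continuous g) (hgi : Integrable g) (hg0 : ∀ y, ‖y‖ < 2 * R → g y = 0) (i : Fin n)
    {x : Eu n} (hx : x ∈ ball (0 : Eu n) R) :
    ‖coordDeriv i (coordDeriv i fun x => ∫ y, Real.log (‖y‖ / ‖x - y‖) * g y) x‖ₑ ≤
      3 * ∫⁻ y, invSq (x - y) * ‖g y‖ₑ := by
  have hsm := contDiffOn_far_potential hR hg hgi hg0
  set u : Eu n → ℝ := fun x => ∫ y, Real.log (‖y‖ / ‖x - y‖) * g y with hu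
  have hne : ∀ {x y : Eu n}, x ∈ ball (0 : Eu n) R → 2 * R ≤ ‖y‖ → x - y ≠ 0 := fun hx hy =>
    norm_pos_iff.1 (hR.trans_le (le_norm_sub hx hy))
  have hM1 : ∀ x ∈ ball (0 : Eu n) R, ∀ y, 2 * R ≤ ‖y‖ →
      |-((x - y) i / ‖x - y‖ ^ 2)| ≤ R⁻¹ := by
    intro x hx y hy
    have h1 := le_norm_sub hx hy
    have h2 : 0 < ‖x - y‖ := hR.trans_le h1
    rw [abs_neg, abs_div, abs_of_pos (pow_pos h2 2), div_le_iff₀ (pow_pos h2 2)]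
    refine (abs_coord_le_norm _ i).trans ?_
    rw [inv_mul_eq_div, le_div_iff₀ hR]
    nlinarith
  have hM2 : ∀ x ∈ ball (0 : Eu n) R, ∀ y, 2 * R ≤ ‖y‖ →
      |-(1 / ‖x - y‖ ^ 2 - 2 * (x - y) i ^ 2 / (‖x - y‖ ^ 2) ^ 2)| ≤ 3 * (‖x - y‖ ^ 2)⁻¹ := by
    intro x hx y hy
    have h2 : 0 < ‖x - y‖ := hR.trans_le (le_norm_sub hx hy)
    rw [abs_neg]
    refine abs_second_deriv_log_le (by positivity) ?_ (by positivity) le_rfl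
    rw [← sq_abs]
    gcongr
    exact abs_coord_le_norm _ i
  have hM2' : ∀ x ∈ ball (0 : Eu n) R, ∀ y, 2 * R ≤ ‖y‖ →
      |-(1 / ‖x - y‖ ^ 2 - 2 * (x - y) i ^ 2 / (‖x - y‖ ^ 2) ^ 2)| ≤ 3 * (R ^ 2)⁻¹ := by
    intro x hx y hy
    refine (hM2 x hx y hy).trans ?_
    have := le_norm_sub hx hy
    gcongr
  have hcoord : ∀ x : Eu n, Measurable fun y : Eu n => (x - y) i := fun x => by fun_prop
  have hm0 : ∀ x : Eu n, Measurable fun y : Eu n => Real.log (‖y‖ / ‖x - y‖) := fun x => by fun_prop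
  have hm1 : ∀ x : Eu n, Measurable fun y : Eu n => -((x - y) i / ‖x - y‖ ^ 2) := fun x =>
    ((hcoord x).div (by fun_prop)).neg
  have hm2 : ∀ x : Eu n, Measurable fun y : Eu n =>
      -(1 / ‖x - y‖ ^ 2 - 2 * (x - y) i ^ 2 / (‖x - y‖ ^ 2) ^ 2) := fun x =>
    (Measurable.sub (by fun_prop) ((((hcoord x).pow_const 2).const_mul 2).div (by fun_prop))).neg
  have hd1 : ∀ x ∈ ball (0 : Eu n) R, coordDeriv i u x =
      ∫ y, -((x - y) i / ‖x - y‖ ^ 2) * g y := by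
    intro x hx
    refine coordDeriv_integral_mul (R := R) (M := max 6 R⁻¹) i hgi hg0 hm0 hm1
      (fun x hx y hy => (abs_log_norm_div_le hR hx hy).trans (le_max_left _ _))
      (fun x hx y hy => (hM1 x hx y hy).trans (le_max_right _ _)) (fun x y t ht hy => ?_)
      (fun _ _ => rfl) hx ?_
    · exact hasDerivAt_log_norm_div i (norm_pos_iff.1 (by linarith)) (hne ht hy)
    · exact ((hsm x hx).contDiffAt (isOpen_ball.mem_nhds hx)).differentiableAt (by simp)
  have hd2 : coordDeriv i (coordDeriv i u) x =
      ∫ y, -(1 / ‖x - y‖ ^ 2 - 2 * (x - y) i ^ 2 / (‖x - y‖ ^ 2) ^ 2) * g y := by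
    refine coordDeriv_integral_mul (R := R) (M := max R⁻¹ (3 * (R ^ 2)⁻¹)) i hgi hg0 hm1 hm2
      (fun x hx y hy => (hM1 x hx y hy).trans (le_max_left _ _))
      (fun x hx y hy => (hM2' x hx y hy).trans (le_max_right _ _)) (fun x y t ht hy => ?_)
      hd1 hx ?_
    · exact hasDerivAt_neg_coord_div_norm_sq i (hne ht hy)
    · have hc : ContDiffAt ℝ (⊤ : ℕ∞) u x := (hsm x hx).contDiffAt (isOpen_ball.mem_nhds hx)
      exact ((hc.fderiv_right (m := (⊤ : ℕ∞)) (by simp)).differentiableAt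
        (by simp)).clm_apply (differentiableAt_const _)
  rw [hd2]
  refine (enorm_integral_le_lintegral_enorm _).trans ?_
  rw [← lintegral_const_mul' _ _ (by simp)]
  refine lintegral_mono fun y => ?_
  rw [enorm_mul, ← mul_assoc]
  by_cases hy : ‖y‖ < 2 * R
  · simp [hg0 y hy]
  · gcongr
    rw [invSq_eq_ofReal (hne hx (not_lt.1 hy)), Real.enorm_eq_ofReal_abs,
      show (3 : ENNReal) = ENNReal.ofReal 3 by simp, ← ENNReal.ofReal_mul (by norm_num)]
    exact ENNReal.ofReal_le_ofReal (hM2 x hx y (not_lt.1 hy))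

lemma lap_eq_sum_coordDeriv {n : ℕ} {u : Eu n → ℝ} (hu : ContDiff ℝ (⊤ : ℕ∞) u) (x : Eu n) :
    lap u x = ∑ i : Fin n, coordDeriv i (coordDeriv i u) x := by
  refine Finset.sum_congr rfl fun i _ => ?_
  have hd : DifferentiableAt ℝ (fderiv ℝ u) x :=
    (hu.fderiv_right (m := (⊤ : ℕ∞)) (by simp)).differentiable (by simp) x
  have h := (hd.hasFDerivAt.clm_apply
    (hasFDerivAt_const (EuclideanSpace.single i (1 : ℝ)) x)).fderiv
  rw [iteratedFDeriv_two_apply, coordDeriv]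
  unfold coordDeriv
  rw [h]
  simp

/-- Splitting of a density into a compactly supported part and a part vanishing on a ball. -/
lemma exists_split {n : ℕ} {R : ℝ} (hR : 0 < R) {f : Eu n → ℝ} (hf : ContDiff ℝ (⊤ : ℕ∞) f)
    (hfi : Integrable f) :
    ∃ h g : Eu n → ℝ, ContDiff ℝ (⊤ : ℕ∞) h ∧ HasCompactSupport h ∧ Continuous g ∧ Integrable g ∧
      (∀ y, ‖y‖ < 2 * R → g y = 0) ∧ (∀ y, f y = h y + g y) ∧
      (∀ y, ‖h y‖ₑ ≤ ‖f y‖ₑ) ∧ ∀ y, ‖g y‖ₑ ≤ ‖f y‖ₑ := by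
  let χ : ContDiffBump (0 : Eu n) :=
    { rIn := 2 * R, rOut := 3 * R, rIn_pos := by positivity, rIn_lt_rOut := by linarith }
  have hχ0 : ∀ y, 0 ≤ χ y := fun y => χ.nonneg
  have hχ1 : ∀ y, χ y ≤ 1 := fun y => χ.le_one
  have hh : ∀ y, ‖χ y * f y‖ ≤ ‖f y‖ := fun y => by
    rw [norm_mul, Real.norm_of_nonneg (hχ0 y)]
    exact mul_le_of_le_one_left (norm_nonneg _) (hχ1 y)
  have hg : ∀ y, ‖(1 - χ y) * f y‖ ≤ ‖f y‖ := fun y => by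
    rw [norm_mul, Real.norm_of_nonneg (sub_nonneg.2 (hχ1 y))]
    exact mul_le_of_le_one_left (norm_nonneg _) (by linarith [hχ0 y])
  have hgc : Continuous fun y => (1 - χ y) * f y :=
    (continuous_const.sub χ.continuous).mul hf.continuous
  refine ⟨fun y => χ y * f y, fun y => (1 - χ y) * f y, χ.contDiff.mul hf,
    χ.hasCompactSupport.mul_right, hgc, hfi.mono hgc.aestronglyMeasurable (ae_of_all _ hg),
    fun y hy => ?_, fun y => by ring, fun y => ?_, fun y => ?_⟩
  · have : χ y = 1 := χ.one_of_mem_closedBall (mem_closedBall_zero_iff.2 hy.le)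
    simp [this]
  · exact enorm_le_iff_norm_le.2 (hh y)
  · exact enorm_le_iff_norm_le.2 (hg y)

/-- Near the origin, the potential is a constant, minus a compactly supported logarithmic
potential, plus the potential of a density vanishing near the origin. -/
lemma potential_split {n : ℕ} (hn : 4 ≤ n) {R : ℝ} (hR : 0 < R) {h g f : Eu n → ℝ}
    (hh : Continuous h) (hc : HasCompactSupport h) (hgi : Integrable g)
    (hg0 : ∀ y, ‖y‖ < 2 * R → g y = 0) (hf : ∀ y, f y = h y + g y) {x : Eu n}
    (hx : x ∈ ball (0 : Eu n) R) :
    Integrable (fun y => Real.log (‖y‖ / ‖x - y‖) * f y) ∧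
      ∫ y, Real.log (‖y‖ / ‖x - y‖) * f y = ((∫ y, Real.log ‖y‖ * h y) -
        ∫ y, Real.log ‖x - y‖ * h y) + ∫ y, Real.log (‖y‖ / ‖x - y‖) * g y := by
  have := nontrivial_eu hn
  have hk := locallyIntegrable_log_norm hn
  have i1 : Integrable fun y => Real.log ‖y‖ * h y :=
    hk.integrable_smul_right_of_hasCompactSupport hh hc
  have i2 : Integrable fun y => Real.log ‖x - y‖ * h y := by
    have := (hc.convolutionExists_right (ContinuousLinearMap.mul ℝ ℝ) hk hh x).integrable_swap
    simpa using this
  have i3 : Integrable fun y => Real.log (‖y‖ / ‖x - y‖) * g y := by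
    have hm : Measurable fun y : Eu n => Real.log (‖y‖ / ‖x - y‖) := by fun_prop
    refine (hgi.norm.const_mul 6).mono' (hm.aestronglyMeasurable.mul hgi.aestronglyMeasurable)
      (ae_of_all _ fun y => ?_)
    rw [norm_mul]
    by_cases hy : ‖y‖ < 2 * R
    · simp [hg0 y hy]
    · exact mul_le_mul_of_nonneg_right (abs_log_norm_div_le hR hx (not_lt.1 hy)) (norm_nonneg _)
  have hae : (fun y => Real.log (‖y‖ / ‖x - y‖) * f y) =ᵐ[volume] fun y =>
      (Real.log ‖y‖ * h y - Real.log ‖x - y‖ * h y) + Real.log (‖y‖ / ‖x - y‖) * g y := by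
    have h0 : ∀ᵐ y : Eu n, y ≠ 0 := by simp [ae_iff]
    have hx : ∀ᵐ y : Eu n, y ≠ x := by simp [ae_iff]
    filter_upwards [h0, hx] with y hy0 hyx
    rw [hf, mul_add, ← sub_mul, ← Real.log_div (norm_ne_zero_iff.2 hy0)
      (norm_ne_zero_iff.2 (sub_ne_zero.2 hyx.symm))]
  have i12 : Integrable fun y => Real.log ‖y‖ * h y - Real.log ‖x - y‖ * h y := i1.sub i2
  refine ⟨(i12.add i3).congr hae.symm, ?_⟩
  rw [integral_congr_ae hae, integral_add i12 i3, integral_sub i1 i2]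

lemma coordDeriv_const_sub_add {n : ℕ} (i : Fin n) (c : ℝ) {v u w : Eu n → ℝ} {x : Eu n}
    (h : v =ᶠ[nhds x] fun z => (c - u z) + w z)
    (hu : DifferentiableAt ℝ u x) (hw : DifferentiableAt ℝ w x) :
    coordDeriv i v x = (0 - coordDeriv i u x) + coordDeriv i w x := by
  have := ((hu.hasFDerivAt.const_sub c).add hw.hasFDerivAt).congr_of_eventuallyEq h
  rw [coordDeriv, this.fderiv]
  simp [coordDeriv]

/-- Regularity of the logarithmic potential, and the pointwise bound of its Laplacian by the
Riesz-type potential with kernel `‖z‖⁻²`. -/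
lemma potential_local {n : ℕ} (hn : 4 ≤ n) {f v : Eu n → ℝ} (hf : ContDiff ℝ (⊤ : ℕ∞) f)
    (hfi : Integrable f) (hv : ∀ x, v x = ∫ y, Real.log (‖y‖ / ‖x - y‖) * f y) (x : Eu n) :
    Integrable (fun y => Real.log (‖y‖ / ‖x - y‖) * f y) ∧ ContDiffAt ℝ (⊤ : ℕ∞) v x ∧
      ∀ i, ‖coordDeriv i (coordDeriv i v) x‖ₑ ≤ 6 * ∫⁻ y, invSq (x - y) * ‖f y‖ₑ := by
  have hR : 0 < ‖x‖ + 1 := by positivity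
  have hxR : x ∈ ball (0 : Eu n) (‖x‖ + 1) := by simp
  generalize ‖x‖ + 1 = R at hR hxR
  obtain ⟨h, g, hh, hc, hg, hgi, hg0, hfs, hhf, hgf⟩ := exists_split hR hf hfi
  set u : Eu n → ℝ := fun x => ∫ y, Real.log ‖x - y‖ * h y with hu
  set w : Eu n → ℝ := fun x => ∫ y, Real.log (‖y‖ / ‖x - y‖) * g y with hw
  set c : ℝ := ∫ y, Real.log ‖y‖ * h y with hcc
  have hvs : ∀ z ∈ ball (0 : Eu n) R, v z = (c - u z) + w z := fun z hz => by
    rw [hv z, (potential_split hn hR hh.continuous hc hgi hg0 hfs hz).2]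
  have hev : ∀ z ∈ ball (0 : Eu n) R, v =ᶠ[nhds z] fun z => (c - u z) + w z := fun z hz =>
    Filter.eventuallyEq_of_mem (isOpen_ball.mem_nhds hz) hvs
  have hus : ContDiff ℝ (⊤ : ℕ∞) u := contDiff_log_potential hn hh hc
  have hws : ∀ z ∈ ball (0 : Eu n) R, ContDiffAt ℝ (⊤ : ℕ∞) w z := fun z hz =>
    (contDiffOn_far_potential hR hg hgi hg0 z hz).contDiffAt (isOpen_ball.mem_nhds hz)
  refine ⟨(potential_split hn hR hh.continuous hc hgi hg0 hfs hxR).1, ?_, fun i => ?_⟩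
  · exact ((contDiffAt_const.sub hus.contDiffAt).add (hws x hxR)).congr_of_eventuallyEq (hev x hxR)
  · have h1 : ∀ z ∈ ball (0 : Eu n) R, coordDeriv i v z =
        (0 - coordDeriv i u z) + coordDeriv i w z := fun z hz =>
      coordDeriv_const_sub_add i c (hev z hz) (hus.differentiable (by simp) z)
        ((hws z hz).differentiableAt (by simp))
    have h2 := coordDeriv_const_sub_add i 0
      (Filter.eventuallyEq_of_mem (isOpen_ball.mem_nhds hxR) h1)
      ((contDiff_coordDeriv i hus).differentiable (by simp) x)
      ((((hws x hxR).fderiv_right (m := (⊤ : ℕ∞)) (by simp)).differentiableAt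
        (by simp)).clm_apply (differentiableAt_const _))
    rw [h2, zero_sub]
    refine (enorm_add_le _ _).trans ?_
    rw [enorm_neg, show (6 : ENNReal) = 3 + 3 by norm_num, add_mul]
    refine add_le_add
      ((enorm_coordDeriv_coordDeriv_log_potential_le hn hh hc i x).trans ?_)
      ((enorm_coordDeriv_coordDeriv_far_potential_le hR hg hgi hg0 i hxR).trans ?_)
    · gcongr with y
      exact hhf y
    · gcongr with y
      exact hgf y

lemma lintegral_invSq_ball_one_lt_top {n : ℕ} (hn : 4 ≤ n) :
    ∫⁻ z in ball (0 : Eu n) 1, invSq z < ⊤ := by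
  have := nontrivial_eu hn
  have h := (integrableOn_inv_norm_sq hn 1).hasFiniteIntegral
  refine lt_of_le_of_lt (le_of_eq ?_) h
  have h0 : ∀ᵐ z : Eu n, z ≠ 0 := by simp [ae_iff]
  refine lintegral_congr_ae (ae_restrict_of_ae ?_)
  filter_upwards [h0] with z hz
  rw [invSq_eq_ofReal hz, Real.enorm_of_nonneg (by positivity)]

lemma lintegral_invSq_ball {n : ℕ} (hn : 4 ≤ n) {r : ℝ} (hr : 0 < r) :
    ∫⁻ z in ball (0 : Eu n) r, invSq z =
      ENNReal.ofReal (r ^ (n - 2)) * ∫⁻ z in ball (0 : Eu n) 1, invSq z := by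
  have hmap := Measure.map_addHaar_smul (volume : Measure (Eu n)) hr.ne'
  have hm : Measurable ((ball (0 : Eu n) r).indicator invSq) :=
    measurable_invSq.indicator measurableSet_ball
  have h1 : ∫⁻ z, (ball (0 : Eu n) r).indicator invSq z ∂(volume.map (r • ·)) =
      ENNReal.ofReal ((r ^ 2)⁻¹) * ∫⁻ z in ball (0 : Eu n) 1, invSq z := by
    rw [lintegral_map hm (measurable_const_smul r), ← lintegral_indicator measurableSet_ball,
      ← lintegral_const_mul' _ _ (by simp)]
    refine lintegral_congr fun z => ?_
    have hz : r • z ∈ ball (0 : Eu n) r ↔ z ∈ ball (0 : Eu n) 1 := by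
      rw [mem_ball_zero_iff, mem_ball_zero_iff, norm_smul, Real.norm_of_nonneg hr.le]
      constructor
      · intro h; nlinarith
      · intro h; nlinarith
    by_cases h : z ∈ ball (0 : Eu n) 1
    · rw [indicator_of_mem h, indicator_of_mem (hz.2 h), invSq, invSq, enorm_smul, mul_pow,
        ENNReal.mul_inv (by simp [hr.ne']) (by simp), ENNReal.ofReal_inv_of_pos (by positivity),
        Real.enorm_of_nonneg hr.le, ENNReal.ofReal_pow hr.le]
    · rw [indicator_of_notMem h, indicator_of_notMem (mt hz.1 h), mul_zero]
  rw [hmap, lintegral_smul_measure, lintegral_indicator measurableSet_ball,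
    finrank_euclideanSpace, Fintype.card_fin, smul_eq_mul, abs_of_pos (by positivity)] at h1
  have h2 : ENNReal.ofReal (r ^ n) * ENNReal.ofReal ((r ^ n)⁻¹) = 1 := by
    rw [← ENNReal.ofReal_mul (by positivity), mul_inv_cancel₀ (by positivity), ENNReal.ofReal_one]
  rw [← one_mul (∫⁻ z in ball (0 : Eu n) r, invSq z), ← h2, mul_assoc, h1, ← mul_assoc,
    ← ENNReal.ofReal_mul (by positivity)]
  congr 2
  obtain ⟨m, rfl⟩ : ∃ m, n = m + 2 := ⟨n - 2, by omega⟩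
  rw [Nat.add_sub_cancel, pow_add]
  field_simp

/-- The dimensional constant in `∫_{B_{2r}} ‖x - y‖⁻² dx ≤ C r^{n-2}`. -/
def rieszConst (n : ℕ) : ENNReal :=
  (∫⁻ z in ball (0 : Eu n) 1, invSq z) + ENNReal.ofReal (2 ^ n) * volume (ball (0 : Eu n) 1)

lemma rieszConst_ne_top {n : ℕ} (hn : 4 ≤ n) : rieszConst n ≠ ⊤ :=
  ENNReal.add_ne_top.2 ⟨(lintegral_invSq_ball_one_lt_top hn).ne,
    ENNReal.mul_ne_top ENNReal.ofReal_ne_top measure_ball_lt_top.ne⟩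

lemma lintegral_invSq_sub_ball_le {n : ℕ} (hn : 4 ≤ n) {r : ℝ} (hr : 0 < r) (y : Eu n) :
    ∫⁻ x in ball (0 : Eu n) (2 * r), invSq (x - y) ≤
      ENNReal.ofReal (r ^ (n - 2)) * rieszConst n := by
  have hpt : ∀ x : Eu n, invSq (x - y) ≤
      (ball (0 : Eu n) r).indicator invSq (x - y) + ENNReal.ofReal ((r ^ 2)⁻¹) := by
    intro x
    by_cases h : x - y ∈ ball (0 : Eu n) r
    · rw [indicator_of_mem h]; exact le_self_add
    · rw [mem_ball_zero_iff, not_lt] at h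
      have hne : x - y ≠ 0 := norm_pos_iff.1 (hr.trans_le h)
      refine le_add_of_nonneg_of_le bot_le ?_
      rw [invSq_eq_ofReal hne]
      refine ENNReal.ofReal_le_ofReal ?_
      gcongr
  have hm : Measurable ((ball (0 : Eu n) r).indicator (invSq (n := n))) :=
    measurable_invSq.indicator measurableSet_ball
  calc ∫⁻ x in ball (0 : Eu n) (2 * r), invSq (x - y)
      ≤ ∫⁻ x in ball (0 : Eu n) (2 * r),
          ((ball (0 : Eu n) r).indicator invSq (x - y) + ENNReal.ofReal ((r ^ 2)⁻¹)) :=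
        lintegral_mono hpt
    _ = (∫⁻ x in ball (0 : Eu n) (2 * r), (ball (0 : Eu n) r).indicator invSq (x - y)) +
          ENNReal.ofReal ((r ^ 2)⁻¹) * volume (ball (0 : Eu n) (2 * r)) := by
        rw [lintegral_add_right _ measurable_const, setLIntegral_const]
    _ ≤ (∫⁻ x, (ball (0 : Eu n) r).indicator invSq (x - y)) +
          ENNReal.ofReal ((r ^ 2)⁻¹) * volume (ball (0 : Eu n) (2 * r)) := by
        gcongr
        exact Measure.restrict_le_self
    _ = ENNReal.ofReal (r ^ (n - 2)) * rieszConst n := by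
        rw [lintegral_sub_right_eq_self (fun z => (ball (0 : Eu n) r).indicator invSq z) y,
          lintegral_indicator measurableSet_ball, lintegral_invSq_ball hn hr, rieszConst, mul_add,
          Measure.addHaar_ball_of_pos _ _ (by positivity), finrank_euclideanSpace, Fintype.card_fin,
          ← mul_assoc, ← mul_assoc, ← ENNReal.ofReal_mul (by positivity),
          ← ENNReal.ofReal_mul (by positivity)]
        congr 3
        obtain ⟨m, rfl⟩ : ∃ m, n = m + 2 := ⟨n - 2, by omega⟩
        rw [Nat.add_sub_cancel, mul_pow, pow_add r]
        field_simp

lemma enorm_lap_potential_le {n : ℕ} (hn : 4 ≤ n) {f v : Eu n → ℝ} (hf : ContDiff ℝ (⊤ : ℕ∞) f)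
    (hfi : Integrable f) (hv : ∀ x, v x = ∫ y, Real.log (‖y‖ / ‖x - y‖) * f y)
    (hvs : ContDiff ℝ (⊤ : ℕ∞) v) (x : Eu n) :
    ‖lap v x‖ₑ ≤ ENNReal.ofReal (6 * n) * ∫⁻ y, invSq (x - y) * ‖f y‖ₑ := by
  rw [lap_eq_sum_coordDeriv hvs]
  refine (enorm_sum_le _ _).trans ?_
  refine (Finset.sum_le_sum fun i _ => (potential_local hn hf hfi hv x).2.2 i).trans (le_of_eq ?_)
  rw [Finset.sum_const, Finset.card_univ, Fintype.card_fin, nsmul_eq_mul, ← mul_assoc,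
    ENNReal.ofReal_mul (by norm_num)]
  simp [mul_comm]

lemma lintegral_lap_potential_le {n : ℕ} (hn : 4 ≤ n) {f v : Eu n → ℝ}
    (hf : ContDiff ℝ (⊤ : ℕ∞) f) (hfi : Integrable f)
    (hv : ∀ x, v x = ∫ y, Real.log (‖y‖ / ‖x - y‖) * f y) (hvs : ContDiff ℝ (⊤ : ℕ∞) v)
    {r : ℝ} (hr : 0 < r) :
    ∫⁻ x in ball (0 : Eu n) (2 * r), ‖lap v x‖ₑ ≤
      ENNReal.ofReal (6 * n) * ((∫⁻ y, ‖f y‖ₑ) * (ENNReal.ofReal (r ^ (n - 2)) * rieszConst n)) := by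
  have hfm : Measurable fun y => ‖f y‖ₑ := hf.continuous.measurable.enorm
  have hm : Measurable fun p : Eu n × Eu n => invSq (p.1 - p.2) * ‖f p.2‖ₑ :=
    (measurable_invSq.comp (measurable_fst.sub measurable_snd)).mul (hfm.comp measurable_snd)
  refine (lintegral_mono fun x => enorm_lap_potential_le hn hf hfi hv hvs x).trans ?_
  rw [lintegral_const_mul' _ _ ENNReal.ofReal_ne_top]
  gcongr
  rw [lintegral_lintegral_swap hm.aemeasurable, ← lintegral_mul_const _ hfm]
  refine lintegral_mono fun y => ?_
  have hy : Measurable fun x : Eu n => invSq (x - y) :=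
    measurable_invSq.comp (measurable_id.sub_const y)
  rw [lintegral_mul_const _ hy, mul_comm]
  gcongr
  exact lintegral_invSq_sub_ball_le hn hr y

lemma abs_setIntegral_lap_potential_le {n : ℕ} (hn : 4 ≤ n) {f v : Eu n → ℝ}
    (hf : ContDiff ℝ (⊤ : ℕ∞) f) (hfi : Integrable f)
    (hv : ∀ x, v x = ∫ y, Real.log (‖y‖ / ‖x - y‖) * f y) (hvs : ContDiff ℝ (⊤ : ℕ∞) v)
    {r : ℝ} (hr : 0 < r) {s : Set (Eu n)} (hs : s ⊆ ball 0 (2 * r)) :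
    |∫ x in s, lap v x| ≤ 6 * n * (rieszConst n).toReal * (∫ y, |f y|) * r ^ (n - 2) := by
  have h := (enorm_integral_le_lintegral_enorm (μ := volume.restrict s) (lap v)).trans
    ((lintegral_mono_set hs).trans (lintegral_lap_potential_le hn hf hfi hv hvs hr))
  rw [Real.enorm_eq_ofReal_abs, ← ofReal_integral_norm_eq_lintegral_enorm hfi,
    ← ENNReal.ofReal_toReal (rieszConst_ne_top hn), ← ENNReal.ofReal_mul (by positivity),
    ← ENNReal.ofReal_mul (by positivity), ← ENNReal.ofReal_mul (by positivity),
    ENNReal.ofReal_le_ofReal_iff (by positivity)] at h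
  refine h.trans (le_of_eq ?_)
  simp only [Real.norm_eq_abs]
  ring

lemma pow_mul_volume_ball_le_volume_annulus {n : ℕ} (hn : 4 ≤ n) {r : ℝ} (hr : 0 < r) :
    r ^ n * volume.real (ball (0 : Eu n) 1) ≤
      volume.real (ball (0 : Eu n) (2 * r) \ ball 0 r) := by
  have hball : ∀ s : ℝ, 0 < s → volume.real (ball (0 : Eu n) s) =
      s ^ n * volume.real (ball (0 : Eu n) 1) := fun s hs => by
    rw [Measure.real, Measure.addHaar_ball_of_pos _ _ hs, finrank_euclideanSpace,
      Fintype.card_fin, ENNReal.toReal_mul, ENNReal.toReal_ofReal (by positivity), Measure.real]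
  rw [measureReal_sdiff (ball_subset_ball (by linarith)) measurableSet_ball
    measure_ball_lt_top.ne, hball (2 * r) (by positivity), hball r hr, mul_pow]
  have h2 : (2 : ℝ) ≤ 2 ^ n := by
    calc (2 : ℝ) = 2 ^ 1 := by norm_num
      _ ≤ 2 ^ n := pow_le_pow_right₀ (by norm_num) (by omega)
  have h3 : 0 ≤ r ^ n * volume.real (ball (0 : Eu n) 1) := by positivity
  nlinarith

/-- **Annulus estimate for `∫ Δv` of a logarithmic potential.** For `f ∈ C^∞ ∩ L¹(ℝⁿ)`,
`n ≥ 4` even, the potential `v(x) = ∫ log(|y|/|x-y|) f(y) dy` is a well-defined smooth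
function and `|∫_{B_{2r}∖B_r} Δv| ≤ C(n) (∫|f|) r^{n-2}`, hence
`|⨍_{B_{2r}∖B_r} Δv| ≤ C (∫|f|) r^{-2}`. -/
theorem annulus_laplacian_potential_estimate
    (n : ℕ) (hn : 4 ≤ n) (hev : Even n) :
    ∃ C : ℝ, 0 < C ∧
      ∀ f : Eu n → ℝ, ContDiff ℝ (⊤ : ℕ∞) f → Integrable f →
        ∀ v : Eu n → ℝ,
          (∀ x, v x = ∫ y, Real.log (‖y‖ / ‖x - y‖) * f y) →
            (∀ x, Integrable (fun y => Real.log (‖y‖ / ‖x - y‖) * f y)) ∧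
            ContDiff ℝ (⊤ : ℕ∞) v ∧
            ∀ r : ℝ, 0 < r →
              |∫ x in ball (0 : Eu n) (2 * r) \ ball 0 r, lap v x| ≤
                  C * (∫ y, |f y|) * r ^ (n - 2) ∧
                |⨍ x in ball (0 : Eu n) (2 * r) \ ball 0 r, lap v x| ≤
                  C * (∫ y, |f y|) / r ^ 2 := by
  set b : ℝ := volume.real (ball (0 : Eu n) 1) with hb
  have hb0 : 0 < b := ENNReal.toReal_pos (measure_ball_pos _ _ one_pos).ne' measure_ball_lt_top.ne
  set K : ℝ := 6 * n * (rieszConst n).toReal with hK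
  have hK0 : 0 ≤ K := by positivity
  have hC1 : K ≤ (K + 1) * (1 + b⁻¹) := by nlinarith [inv_pos.2 hb0]
  have hC2 : K * b⁻¹ ≤ (K + 1) * (1 + b⁻¹) := by nlinarith [inv_pos.2 hb0]
  refine ⟨(K + 1) * (1 + b⁻¹), by positivity, fun f hf hfi v hv => ?_⟩
  have hvs : ContDiff ℝ (⊤ : ℕ∞) v :=
    contDiff_iff_contDiffAt.2 fun x => (potential_local hn hf hfi hv x).2.1
  refine ⟨fun x => (potential_local hn hf hfi hv x).1, hvs, fun r hr => ?_⟩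
  have hI : 0 ≤ ∫ y, |f y| := integral_nonneg fun y => abs_nonneg _
  have hmain := abs_setIntegral_lap_potential_le hn hf hfi hv hvs hr
    (sdiff_subset : ball (0 : Eu n) (2 * r) \ ball 0 r ⊆ ball 0 (2 * r))
  rw [← hK] at hmain
  refine ⟨hmain.trans (by gcongr), ?_⟩
  have hvol := pow_mul_volume_ball_le_volume_annulus hn hr
  rw [← hb] at hvol
  have hrn : 0 < r ^ n * b := by positivity
  rw [setAverage_eq, smul_eq_mul, abs_mul, abs_of_nonneg (by positivity)]
  calc (volume.real (ball (0 : Eu n) (2 * r) \ ball 0 r))⁻¹ *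
        |∫ x in ball (0 : Eu n) (2 * r) \ ball 0 r, lap v x|
      ≤ (r ^ n * b)⁻¹ * (K * (∫ y, |f y|) * r ^ (n - 2)) := by gcongr
    _ = K * b⁻¹ * (∫ y, |f y|) / r ^ 2 := by
        obtain ⟨m, rfl⟩ : ∃ m, n = m + 2 := ⟨n - 2, by omega⟩
        rw [Nat.add_sub_cancel, pow_add]
        field_simp
    _ ≤ (K + 1) * (1 + b⁻¹) * (∫ y, |f y|) / r ^ 2 := by gcongr
end
end
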